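/- Let h : ℝ → [0,1] satisfy h(t) = 1 for |t| ≤ 1, h(t) = 0 for |t| ≥ 2, and |h(s) − h(t)| ≤ L |s − t| for all s, t ∈ ℝ, where L > 0. For k ∈ ℤ define T_k(1)(x) := ∫_{ℝ^N} h(2^k d(x,y)) dy. Then for every k ∈ ℤ and all x, x' ∈ ℝ^N with d(x,x') ≤ 2^{-k}, one has |1/T_k(1)(x) − 1/T_k(1)(x')| ≤ C · 2^{kN} · 2^k d(x,x'), where C depends only on N, L and the cardinality |G| of G. -/

import Mathlib

open MeasureTheory ENNReal

abbrev Euc (N : ℕ) := EuclideanSpace ℝ (Fin N)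

abbrev OrthG (N : ℕ) := Euc N ≃ₗᵢ[ℝ] Euc N

/-- `d(x,y) := min_{σ ∈ G} ‖x - σ(y)‖`. -/
noncomputable def refDist {N : ℕ} (G : Subgroup (OrthG N)) (x y : Euc N) : ℝ :=
  sInf {r : ℝ | ∃ σ ∈ G, r = ‖x - σ y‖}


section RefDist

variable {N : ℕ} (G : Subgroup (OrthG N))

lemma refDist_nonneg (x y : Euc N) : 0 ≤ refDist G x y := by
  apply Real.sInf_nonneg
  rintro _ ⟨σ, -, rfl⟩
  exact norm_nonneg _

lemma refDist_le_norm {σ : OrthG N} (hσ : σ ∈ G) (x y : Euc N) :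
    refDist G x y ≤ ‖x - σ y‖ := by
  refine csInf_le ⟨0, ?_⟩ ⟨σ, hσ, rfl⟩
  rintro _ ⟨τ, -, rfl⟩
  exact norm_nonneg _

lemma refDist_le_dist (x y : Euc N) : refDist G x y ≤ dist x y := by
  simpa [dist_eq_norm] using refDist_le_norm G G.one_mem x y

variable [Finite G]

/-- The minimum defining `refDist` is attained. -/
lemma exists_refDist_eq (x y : Euc N) : ∃ σ ∈ G, refDist G x y = ‖x - σ y‖ := by
  have hfin : {r : ℝ | ∃ σ ∈ G, r = ‖x - σ y‖}.Finite := by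
    refine (Set.finite_range fun σ : G => ‖x - (σ : OrthG N) y‖).subset ?_
    rintro _ ⟨σ, hσ, rfl⟩
    exact ⟨⟨σ, hσ⟩, rfl⟩
  have hne : {r : ℝ | ∃ σ ∈ G, r = ‖x - σ y‖}.Nonempty := ⟨_, 1, G.one_mem, rfl⟩
  exact hne.csInf_mem hfin

lemma refDist_triangle (x y z : Euc N) : refDist G x z ≤ refDist G x y + refDist G y z := by
  obtain ⟨σ, hσ, hxy⟩ := exists_refDist_eq G x y
  obtain ⟨τ, hτ, hyz⟩ := exists_refDist_eq G y z
  have hiso : ‖σ y - σ (τ z)‖ = ‖y - τ z‖ := by rw [← map_sub, σ.norm_map]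
  calc refDist G x z ≤ ‖x - σ (τ z)‖ := refDist_le_norm G (G.mul_mem hσ hτ) x z
    _ ≤ ‖x - σ y‖ + ‖σ y - σ (τ z)‖ := norm_sub_le_norm_sub_add_norm_sub _ _ _
    _ = refDist G x y + refDist G y z := by rw [hiso, hxy, hyz]

lemma refDist_comm (x y : Euc N) : refDist G x y = refDist G y x := by
  have key : ∀ x y : Euc N, refDist G x y ≤ refDist G y x := by
    intro x y
    obtain ⟨σ, hσ, hyx⟩ := exists_refDist_eq G y x
    calc refDist G x y ≤ ‖x - σ⁻¹ y‖ := refDist_le_norm G (G.inv_mem hσ) x y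
      _ = ‖σ (x - σ⁻¹ y)‖ := (σ.norm_map _).symm
      _ = ‖σ x - y‖ := by rw [map_sub]; congr 2; exact σ.apply_symm_apply y
      _ = refDist G y x := by rw [hyx, norm_sub_rev]
  exact le_antisymm (key x y) (key y x)

lemma abs_refDist_sub_le (x x' y : Euc N) :
    |refDist G x y - refDist G x' y| ≤ refDist G x x' := by
  have h₁ := refDist_triangle G x x' y
  have h₂ := refDist_triangle G x' x y
  rw [refDist_comm G x' x] at h₂
  rw [abs_le]
  constructor <;> linarith

lemma continuous_refDist (x : Euc N) : Continuous (refDist G x) := by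
  refine (LipschitzWith.of_dist_le_mul (K := 1) fun y z => ?_).continuous
  rw [Real.dist_eq, refDist_comm G x y, refDist_comm G x z, NNReal.coe_one, one_mul]
  exact (abs_refDist_sub_le G y z x).trans (refDist_le_dist G y z)

/-- A `refDist`-ball is covered by the Euclidean balls centred at the orbit of its centre. -/
lemma setOf_refDist_le_subset (x : Euc N) (r : ℝ) :
    {y | refDist G x y ≤ r} ⊆ ⋃ σ : G, Metric.closedBall ((σ : OrthG N) x) r := by
  intro y hy
  obtain ⟨σ, hσ, hyx⟩ := exists_refDist_eq G y x
  refine Set.mem_iUnion.2 ⟨⟨σ, hσ⟩, ?_⟩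
  rw [Metric.mem_closedBall, dist_eq_norm, ← hyx, refDist_comm]
  exact hy

lemma volume_setOf_refDist_le_lt_top (x : Euc N) (r : ℝ) :
    volume {y | refDist G x y ≤ r} < ∞ := by
  refine (measure_mono (setOf_refDist_le_subset G x r)).trans_lt ?_
  exact (isCompact_iUnion fun σ : G =>
    isCompact_closedBall ((σ : OrthG N) x) r).measure_lt_top

lemma volume_real_setOf_refDist_le (x : Euc N) {r : ℝ} (hr : 0 ≤ r) :
    volume.real {y | refDist G x y ≤ r} ≤
      Nat.card G * (r ^ N * volume.real (Metric.ball (0 : Euc N) 1)) := by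
  have := Fintype.ofFinite G
  have hfin : volume (⋃ σ : G, Metric.closedBall ((σ : OrthG N) x) r) ≠ ∞ :=
    (isCompact_iUnion fun σ : G =>
      isCompact_closedBall ((σ : OrthG N) x) r).measure_lt_top.ne
  calc volume.real {y | refDist G x y ≤ r}
      ≤ volume.real (⋃ σ : G, Metric.closedBall ((σ : OrthG N) x) r) :=
        measureReal_mono (setOf_refDist_le_subset G x r) hfin
    _ ≤ ∑ σ : G, volume.real (Metric.closedBall ((σ : OrthG N) x) r) :=
        measureReal_iUnion_fintype_le _
    _ = Nat.card G * (r ^ N * volume.real (Metric.ball (0 : Euc N) 1)) := by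
        simp [Measure.addHaar_real_closedBall _ _ hr, Nat.card_eq_fintype_card]

variable {h : ℝ → ℝ}

lemma integrable_comp_refDist (hh : Continuous h) (h_mem : ∀ t, h t ∈ Set.Icc (0 : ℝ) 1)
    (h_zero : ∀ t, 2 ≤ |t| → h t = 0) {c : ℝ} (hc : 0 < c) (x : Euc N) :
    Integrable fun y : Euc N => h (c * refDist G x y) := by
  have hcont : Continuous fun y : Euc N => h (c * refDist G x y) :=
    hh.comp (continuous_const.mul (continuous_refDist G x))
  have hsupp : Function.support (fun y : Euc N => h (c * refDist G x y)) ⊆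
      {y | refDist G x y ≤ 2 / c} := by
    intro y hy
    by_contra hlt
    rw [Set.mem_ofPred_eq, not_le, div_lt_iff₀' hc] at hlt
    exact hy (h_zero _ (hlt.le.trans (le_abs_self _)))
  rw [← integrableOn_iff_integrable_of_support_subset hsupp]
  refine Measure.integrableOn_of_bounded (M := 1)
    (volume_setOf_refDist_le_lt_top G x _).ne hcont.aestronglyMeasurable ?_
  refine Filter.Eventually.of_forall fun y => ?_
  rw [Real.norm_of_nonneg (h_mem _).1]
  exact (h_mem _).2

lemma le_integral_comp_refDist (hh : Continuous h) (h_mem : ∀ t, h t ∈ Set.Icc (0 : ℝ) 1)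
    (h_one : ∀ t, |t| ≤ 1 → h t = 1) (h_zero : ∀ t, 2 ≤ |t| → h t = 0) {c : ℝ} (hc : 0 < c)
    (x : Euc N) :
    c⁻¹ ^ N * volume.real (Metric.ball (0 : Euc N) 1) ≤
      ∫ y : Euc N, h (c * refDist G x y) := by
  have hint := integrable_comp_refDist G hh h_mem h_zero hc x
  have hball : ∀ y ∈ Metric.closedBall x c⁻¹, h (c * refDist G x y) = 1 := by
    intro y hy
    apply h_one
    rw [abs_of_nonneg (mul_nonneg hc.le (refDist_nonneg G x y)), ← le_inv_mul_iff₀ hc, mul_one]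
    exact (refDist_le_dist G x y).trans (by rwa [dist_comm])
  calc c⁻¹ ^ N * volume.real (Metric.ball (0 : Euc N) 1)
      = volume.real (Metric.closedBall x c⁻¹) := by
        rw [Measure.addHaar_real_closedBall _ _ (inv_nonneg.2 hc.le), finrank_euclideanSpace_fin]
    _ = ∫ y in Metric.closedBall x c⁻¹, h (c * refDist G x y) := by
        rw [setIntegral_congr_fun Metric.isClosed_closedBall.measurableSet hball]
        simp
    _ ≤ ∫ y : Euc N, h (c * refDist G x y) :=
        setIntegral_le_integral hint (Filter.Eventually.of_forall fun y => (h_mem _).1)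

lemma abs_integral_comp_refDist_sub_le (hh : Continuous h)
    (h_mem : ∀ t, h t ∈ Set.Icc (0 : ℝ) 1) (h_zero : ∀ t, 2 ≤ |t| → h t = 0) {L : ℝ}
    (hL : 0 ≤ L) (h_lip : ∀ s t, |h s - h t| ≤ L * |s - t|) {c : ℝ} (hc : 0 < c)
    {x x' : Euc N} (hx : refDist G x x' ≤ c⁻¹) :
    |(∫ y : Euc N, h (c * refDist G x y)) - ∫ y : Euc N, h (c * refDist G x' y)| ≤
      L * (c * refDist G x x') *
        (Nat.card G * ((3 * c⁻¹) ^ N * volume.real (Metric.ball (0 : Euc N) 1))) := by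
  rw [← integral_sub (integrable_comp_refDist G hh h_mem h_zero hc x)
    (integrable_comp_refDist G hh h_mem h_zero hc x')]
  have hvanish : ∀ y ∉ {y | refDist G x y ≤ 3 * c⁻¹},
      h (c * refDist G x y) - h (c * refDist G x' y) = 0 := by
    intro y hy
    rw [Set.mem_ofPred_eq, not_le] at hy
    have far : ∀ z : Euc N, 2 * c⁻¹ ≤ refDist G z y → h (c * refDist G z y) = 0 := by
      intro z hz
      refine h_zero _ (le_trans ?_ (le_abs_self _))
      rwa [← div_eq_mul_inv, div_le_iff₀' hc] at hz
    have hc' := inv_pos.2 hc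
    rw [far x (by linarith), far x' (by linarith [refDist_triangle G x x' y]), sub_zero]
  have hbound : ∀ y : Euc N, ‖h (c * refDist G x y) - h (c * refDist G x' y)‖ ≤
      L * (c * refDist G x x') := by
    intro y
    refine (h_lip _ _).trans (mul_le_mul_of_nonneg_left ?_ hL)
    rw [← mul_sub, abs_mul, abs_of_pos hc]
    exact mul_le_mul_of_nonneg_left (abs_refDist_sub_le G x x' y) hc.le
  rw [← setIntegral_eq_integral_of_forall_compl_eq_zero hvanish, ← Real.norm_eq_abs]
  refine (norm_setIntegral_le_of_norm_le_const (volume_setOf_refDist_le_lt_top G x _)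
    fun y _ => hbound y).trans (mul_le_mul_of_nonneg_left ?_ ?_)
  · exact volume_real_setOf_refDist_le G x (by positivity)
  · exact mul_nonneg hL (mul_nonneg hc.le (refDist_nonneg G x x'))

end RefDist

lemma abs_inv_sub_inv_le {a b m : ℝ} (hm : 0 < m) (ha : m ≤ a) (hb : m ≤ b) :
    |a⁻¹ - b⁻¹| ≤ |a - b| / m ^ 2 := by
  have ha' := hm.trans_le ha
  have hb' := hm.trans_le hb
  rw [inv_sub_inv ha'.ne' hb'.ne', abs_div, abs_sub_comm, abs_of_pos (mul_pos ha' hb'), sq]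
  gcongr

/-- Lipschitz estimate for `1/T_k(1)`. -/
theorem stmt_8 {N : ℕ} (hN : 1 ≤ N) (G : Subgroup (OrthG N)) [Finite G]
    (L : ℝ) (hL : 0 < L) :
    ∃ C : ℝ, 0 < C ∧
      ∀ h : ℝ → ℝ, (∀ t : ℝ, h t ∈ Set.Icc (0:ℝ) 1) →
        (∀ t : ℝ, |t| ≤ 1 → h t = 1) → (∀ t : ℝ, 2 ≤ |t| → h t = 0) →
        (∀ s t : ℝ, |h s - h t| ≤ L * |s - t|) →
        ∀ (k : ℤ) (x x' : Euc N), refDist G x x' ≤ (2:ℝ) ^ (-k) →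
          |(∫ y : Euc N, h ((2:ℝ) ^ k * refDist G x y))⁻¹ -
              (∫ y : Euc N, h ((2:ℝ) ^ k * refDist G x' y))⁻¹|
            ≤ C * (2:ℝ) ^ (k * (N : ℤ)) * ((2:ℝ) ^ k * refDist G x x') := by
  set V := volume.real (Metric.ball (0 : Euc N) 1) with hV
  have hVpos : 0 < V :=
    ENNReal.toReal_pos (Metric.measure_ball_pos _ _ one_pos).ne' measure_ball_lt_top.ne
  have hcard : (0 : ℝ) < Nat.card G := Nat.cast_pos.2 Nat.card_pos
  refine ⟨Nat.card G * 3 ^ N * L / V, by positivity, ?_⟩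
  intro h h_mem h_one h_zero h_lip k x x' hx
  have hh : Continuous h :=
    (LipschitzWith.of_dist_le_mul (K := ⟨L, hL.le⟩) fun s t => h_lip s t).continuous
  have hc : (0 : ℝ) < 2 ^ k := by positivity
  rw [zpow_neg] at hx
  rw [zpow_mul, zpow_natCast]
  generalize (2 : ℝ) ^ k = c at hc hx ⊢
  have hm : 0 < c⁻¹ ^ N * V := by positivity
  refine (abs_inv_sub_inv_le hm (le_integral_comp_refDist G hh h_mem h_one h_zero hc x)
    (le_integral_comp_refDist G hh h_mem h_one h_zero hc x')).trans ?_
  rw [div_le_iff₀ (by positivity)]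
  refine (abs_integral_comp_refDist_sub_le G hh h_mem h_zero hL.le h_lip hc hx).trans
    (le_of_eq ?_)
  rw [← hV, mul_pow, inv_pow]
  field_simp
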